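/- Let K be a field, R = K[x,y,z], and let I = (f,g,h) be a strict almost complete intersection ideal defining a reduced set of points in P^2, with f,g,h homogeneous of the same degree d, and syzygy generators (P_1,P_2,P_3) of degree d_0 and (Q_1,Q_2,Q_3) of degree d_1 (d_0 + d_1 = d). Write f_1,f_2,f_3 = f,g,h. Then the following sequence of R-modules is exact: 0 → R^3 → R^6 ⊕ R^6 → R^10 → I^3 → 0, where R^10 has basis {e_{ijk} : 1 ≤ i ≤ j ≤ k ≤ 3} mapping onto I^3 by e_{ijk} ↦ f_i f_j f_k; each summand R^6 has basis indexed by pairs {(j,k) : 1 ≤ j ≤ k ≤ 3}, the middle map sending the (j,k)-th basis vector of the first summand to Σ_{i=1}^3 P_i e_{ijk} and of the second summand to Σ_{i=1}^3 Q_i e_{ijk} (indices of e unordered); and the first map sends the k-th basis vector of R^3 (k = 1,2,3) to (−Σ_{j=1}^3 Q_j e^{(1)}_{jk}, Σ_{j=1}^3 P_j e^{(2)}_{jk}), where e^{(1)}, e^{(2)} denote the bases of the two summands. This is the minimal free resolution of I^3, with twists 0 → R(−4d)^3 → R(−3d−d_0)^6 ⊕ R(−3d−d_1)^6 → R(−3d)^10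 → I^3 → 0; up to signs and reordering of summands the first map is given by the matrix Y whose transpose is [[P_1,P_2,P_3,0,0,0,−Q_1,−Q_2,−Q_3,0,0,0],[0,P_1,0,P_2,P_3,0,0,−Q_1,0,−Q_2,−Q_3,0],[0,0,P_1,0,P_2,P_3,0,0,−Q_1,0,−Q_2,−Q_3]]. -/

import Mathlib

open MvPolynomial

noncomputable section

/-- The ideal of `K[x₀,…]` generated by the homogeneous polynomials vanishing at
(a representative vector of) a point of projective space. -/
def pointIdeal {K : Type*} [Field K] {n : ℕ} (v : Fin n → K) :
    Ideal (MvPolynomial (Fin n) K) :=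
  Ideal.span {f | (∃ d, f.IsHomogeneous d) ∧ eval v f = 0}

/-- `I` is the ideal of a finite nonempty set of distinct (reduced) points of
projective space, given by nonzero, pairwise non-proportional representative
vectors `p 0, …, p n`. -/
def DefinesReducedPoints {K : Type*} [Field K] {N : ℕ}
    (I : Ideal (MvPolynomial (Fin (N + 1)) K)) : Prop :=
  ∃ (n : ℕ) (p : Fin (n + 1) → (Fin (N + 1) → K)),
    (∀ i, p i ≠ 0) ∧ (∀ i j, i ≠ j → ∀ t : K, p i ≠ t • p j) ∧
    I = ⨅ i, pointIdeal (p i)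

/-- Index set for the symmetric pairs `{(i,j) : i ≤ j}` in `Fin 3`. -/
abbrev SymPair : Type := {p : Fin 3 × Fin 3 // p.1 ≤ p.2}

/-- The "unordered" unit vector `e_{ij} = e_{ji}` of `R^6`. -/
def symE {R : Type*} [CommRing R] (i j : Fin 3) : SymPair → R :=
  fun q => if q.val = (i, j) ∨ q.val = (j, i) then 1 else 0

/-- Index set for the symmetric triples `{(i,j,k) : i ≤ j ≤ k}` in `Fin 3`. -/
abbrev SymTriple : Type :=
  {t : Fin 3 × Fin 3 × Fin 3 // t.1 ≤ t.2.1 ∧ t.2.1 ≤ t.2.2}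

/-- The "unordered" unit vector `e_{ijk}` of `R^10`. -/
def symE3 {R : Type*} [CommRing R] (i j k : Fin 3) : SymTriple → R :=
  fun q =>
    if ({i, j, k} : Multiset (Fin 3)) = {q.val.1, q.val.2.1, q.val.2.2} then 1
    else 0

theorem exists_koszul_quotient {S : Type*} [CommRing S] [IsDomain S] [DecompositionMonoid S]
    {p q a b F u₁ v₁ u₂ v₂ : S} (hq : q ≠ 0) (hpq : IsRelPrime p q)
    (h₁ : a * F = p * u₁ + q * v₁) (h₂ : b * F = p * u₂ + q * v₂) :
    ∃ w, b * u₁ - a * u₂ = q * w ∧ b * v₁ - a * v₂ = -(p * w) := by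
  have h : p * (b * u₁ - a * u₂) = -(q * (b * v₁ - a * v₂)) := by
    linear_combination (-b) * h₁ + a * h₂
  obtain ⟨w, hw⟩ : q ∣ b * u₁ - a * u₂ :=
    hpq.symm.dvd_of_dvd_mul_left ⟨-(b * v₁ - a * v₂), by rw [h]; ring⟩
  refine ⟨w, hw, mul_left_cancel₀ hq ?_⟩
  rw [hw] at h
  linear_combination h

theorem mem_span_pair_of_koszul_quotient {S : Type*} [CommRing S] [IsDomain S]
    [DecompositionMonoid S] {p q a b F u₁ v₁ u₂ v₂ w : S} (ha : a ≠ 0) (hab : IsRelPrime a b)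
    (h₁ : a * F = p * u₁ + q * v₁)
    (hu : b * u₁ - a * u₂ = q * w) (hv : b * v₁ - a * v₂ = -(p * w))
    (hw : w ∈ Ideal.span {a, b}) : F ∈ Ideal.span {p, q} := by
  obtain ⟨c, e, rfl⟩ := Ideal.mem_span_pair.1 hw
  obtain ⟨s, hs⟩ : a ∣ u₁ - q * e :=
    hab.dvd_of_dvd_mul_left ⟨u₂ + q * c, by linear_combination hu⟩
  obtain ⟨t, ht⟩ : a ∣ v₁ + p * e :=
    hab.dvd_of_dvd_mul_left ⟨v₂ - p * c, by linear_combination hv⟩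
  refine Ideal.mem_span_pair.2 ⟨s, t, mul_left_cancel₀ ha ?_⟩
  linear_combination -h₁ - p * hs - q * ht

/-- Descent along three elements `a, b, c` forming a regular sequence. -/
theorem mem_span_pair_of_mul_mem {S : Type*} [CommRing S] [IsDomain S] [DecompositionMonoid S]
    {p q a b c F : S} (hq : q ≠ 0) (hpq : IsRelPrime p q) (ha : a ≠ 0) (hab : IsRelPrime a b)
    (hc : ∀ w, c * w ∈ Ideal.span {a, b} → w ∈ Ideal.span {a, b})
    (h₁ : a * F ∈ Ideal.span {p, q}) (h₂ : b * F ∈ Ideal.span {p, q})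
    (h₃ : c * F ∈ Ideal.span {p, q}) : F ∈ Ideal.span {p, q} := by
  obtain ⟨u₁, v₁, h₁⟩ := Ideal.mem_span_pair.1 h₁
  obtain ⟨u₂, v₂, h₂⟩ := Ideal.mem_span_pair.1 h₂
  obtain ⟨u₃, v₃, h₃⟩ := Ideal.mem_span_pair.1 h₃
  have h₁' : a * F = p * u₁ + q * v₁ := by linear_combination -h₁
  have h₂' : b * F = p * u₂ + q * v₂ := by linear_combination -h₂
  have h₃' : c * F = p * u₃ + q * v₃ := by linear_combination -h₃
  obtain ⟨w, hu, hv⟩ := exists_koszul_quotient hq hpq h₁' h₂'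
  obtain ⟨w', hu', -⟩ := exists_koszul_quotient hq hpq h₁' h₃'
  obtain ⟨w'', hu'', -⟩ := exists_koszul_quotient hq hpq h₂' h₃'
  refine mem_span_pair_of_koszul_quotient ha hab h₁' hu hv (hc w ?_)
  refine Ideal.mem_span_pair.2 ⟨-w'', w', mul_left_cancel₀ hq ?_⟩
  linear_combination a * hu'' - b * hu' + c * hu

theorem isRelPrime_pow_pow {S : Type*} [CommRing S] [IsDomain S] [DecompositionMonoid S]
    {a b : S} (h : IsRelPrime a b) (m n : ℕ) : IsRelPrime (a ^ m) (b ^ n) := by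
  have key : ∀ {x y : S} (k : ℕ), IsRelPrime x y → IsRelPrime (x ^ k) y := by
    intro x y k h
    induction k with
    | zero => simpa using isRelPrime_one_left
    | succ k ih => rw [pow_succ]; exact ih.mul_left h
  exact key m (key n h.symm).symm

theorem mem_span_X_pow_of_X_pow_mul_mem {K : Type*} [Field K] (N : ℕ)
    (w : MvPolynomial (Fin 3) K)
    (h : X 2 ^ N * w ∈ Ideal.span {(X 0 : MvPolynomial (Fin 3) K) ^ N, X 1 ^ N}) :
    w ∈ Ideal.span {(X 0 : MvPolynomial (Fin 3) K) ^ N, X 1 ^ N} := by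
  have hs : ({(X 0 : MvPolynomial (Fin 3) K) ^ N, X 1 ^ N} : Set (MvPolynomial (Fin 3) K)) =
      (fun s => monomial s (1 : K)) '' {Finsupp.single 0 N, Finsupp.single 1 N} := by
    simp [Set.image_pair, X_pow_eq_monomial]
  rw [hs, mem_ideal_span_monomial_image] at h ⊢
  intro m hm
  have := h (Finsupp.single 2 N + m) (by
    rw [X_pow_eq_monomial, mem_support_iff, coeff_monomial_mul]
    simpa using hm)
  simpa [Finsupp.single_le_iff] using this

theorem isRelPrime_X_pow {K : Type*} [Field K] (N : ℕ) :
    IsRelPrime ((X 0 : MvPolynomial (Fin 3) K) ^ N) (X 1 ^ N) := by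
  apply isRelPrime_pow_pow
  have hX : Irreducible (X 0 : MvPolynomial (Fin 3) K) := (X_prime).irreducible
  rw [hX.isRelPrime_iff_not_dvd]
  simp [X_dvd_X]

/-- `R ⧸ (a, b)` has positive depth when `a, b` are coprime in `R = K[x, y, z]`. -/
theorem mem_span_pair_of_X_pow_mul_mem {K : Type*} [Field K] {a b w : MvPolynomial (Fin 3) K}
    (hb : b ≠ 0) (hab : IsRelPrime a b) (N : ℕ)
    (h : ∀ i, X i ^ N * w ∈ Ideal.span {a, b}) : w ∈ Ideal.span {a, b} :=
  mem_span_pair_of_mul_mem hb hab (pow_ne_zero _ (X_ne_zero 0)) (isRelPrime_X_pow N)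
    (mem_span_X_pow_of_X_pow_mul_mem N) (h 0) (h 1) (h 2)

/-- The linear form with coefficient vector `P`. -/
def linForm {R : Type*} [CommRing R] (P : Fin 3 → R) : MvPolynomial (Fin 3) R :=
  ∑ i, C (P i) * X i

theorem linForm_isHomogeneous {R : Type*} [CommRing R] (P : Fin 3 → R) :
    (linForm P).IsHomogeneous 1 :=
  IsHomogeneous.sum _ _ _ fun i _ => isHomogeneous_C_mul_X (P i) i

theorem coeff_linForm {R : Type*} [CommRing R] (P : Fin 3 → R) (i : Fin 3) :
    coeff (Finsupp.single i 1) (linForm P) = P i := by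
  classical
  simp [linForm, coeff_sum, coeff_C_mul, coeff_X, Finsupp.single_left_inj]

theorem pow_mul_coeff_mem {R : Type*} [CommRing R] (𝔞 : Ideal R) (P : Fin 3 → R)
    (w : MvPolynomial (Fin 3) R) (h : ∀ m, coeff m (linForm P * w) ∈ 𝔞) (i : Fin 3) (t : ℕ) :
    ∀ m : Fin 3 →₀ ℕ, w.totalDegree < m i + t → P i ^ t * coeff m w ∈ 𝔞 := by
  classical
  induction t with
  | zero =>
    intro m hm
    rw [coeff_eq_zero_of_totalDegree_lt]
    · simp
    · refine hm.trans_le ?_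
      exact Finsupp.le_degree i m
  | succ t ih =>
    intro m hm
    have h₁ := h (m + Finsupp.single i 1)
    rw [linForm, Finset.sum_mul, coeff_sum, ← Finset.add_sum_erase _ _ (Finset.mem_univ i)] at h₁
    have h₂ : P i ^ t * ∑ j ∈ Finset.univ.erase i,
        coeff (m + Finsupp.single i 1) (C (P j) * X j * w) ∈ 𝔞 := by
      rw [Finset.mul_sum]
      refine sum_mem fun j hj => ?_
      rw [mul_assoc, coeff_C_mul, coeff_X_mul']
      split_ifs
      · rw [mul_left_comm]
        refine 𝔞.mul_mem_left _ (ih _ ?_)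
        have : j ≠ i := Finset.ne_of_mem_erase hj
        simp [this]
        omega
      · simp
    have h₃ := 𝔞.sub_mem (𝔞.mul_mem_left (P i ^ t) h₁) h₂
    rw [mul_add, add_sub_cancel_right, mul_assoc, coeff_C_mul, add_comm m, coeff_X_mul] at h₃
    rwa [pow_succ, mul_assoc]

theorem span_C_pair {R : Type*} [CommRing R] (a b : R) :
    Ideal.span {(C a : MvPolynomial (Fin 3) R), C b} = (Ideal.span {a, b}).map C := by
  rw [Ideal.map_span, Set.image_pair]

theorem isRelPrime_C {R : Type*} [CommRing R] [IsDomain R] {a b : R} (ha : a ≠ 0)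
    (hab : IsRelPrime a b) : IsRelPrime (C a : MvPolynomial (Fin 3) R) (C b) := by
  rintro c ⟨e, he⟩ hb
  have h0 : c * e ≠ 0 := he ▸ (C_ne_zero.2 ha)
  have h1 := totalDegree_mul_of_isDomain (left_ne_zero_of_mul h0) (right_ne_zero_of_mul h0)
  rw [← he, totalDegree_C] at h1
  have h2 : c = C (c.coeff 0) := totalDegree_eq_zero_iff_eq_C.1 (by omega)
  rw [h2] at hb ⊢
  refine IsUnit.map C (hab ?_ (by simpa using (C_dvd_iff_dvd_coeff _ _).1 hb 0))
  have := (C_dvd_iff_dvd_coeff (c.coeff 0) (C a)).1 ⟨e, by rw [he, ← h2]⟩ 0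
  simpa using this

section Syzygies

variable {R : Type*} [CommRing R] {f P Q : Fin 3 → R}

theorem sum_mul_eq_zero_of_dvd [IsDomain R] {r : R} {v : Fin 3 → R} (hr : r ≠ 0)
    (h : ∑ i, (r * v i) * f i = 0) : ∑ i, v i * f i = 0 := by
  simp_rw [mul_assoc, ← Finset.mul_sum] at h
  exact (mul_eq_zero.1 h).resolve_left hr

theorem exists_eq_of_syzygy
    (hsyz : ∀ v : Fin 3 → R, (∑ i, v i * f i = 0) ↔ v ∈ Submodule.span R {P, Q})
    {v : Fin 3 → R} (hv : ∑ i, v i * f i = 0) : ∃ s t, ∀ i, v i = s * P i + t * Q i := by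
  obtain ⟨s, t, h⟩ := Submodule.mem_span_pair.1 ((hsyz v).1 hv)
  exact ⟨s, t, fun i => by simp [← h]⟩

theorem left_syzygy
    (hsyz : ∀ v : Fin 3 → R, (∑ i, v i * f i = 0) ↔ v ∈ Submodule.span R {P, Q}) :
    ∑ i, P i * f i = 0 :=
  (hsyz P).2 (Submodule.subset_span (by simp))

theorem right_syzygy
    (hsyz : ∀ v : Fin 3 → R, (∑ i, v i * f i = 0) ↔ v ∈ Submodule.span R {P, Q}) :
    ∑ i, Q i * f i = 0 :=
  (hsyz Q).2 (Submodule.subset_span (by simp))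

theorem cross_ne_zero [IsDomain R] (hf : ∀ i, f i ≠ 0)
    (hsyz : ∀ v : Fin 3 → R, (∑ i, v i * f i = 0) ↔ v ∈ Submodule.span R {P, Q}) :
    crossProduct P Q 0 ≠ 0 := by
  obtain ⟨s, t, h⟩ := exists_eq_of_syzygy hsyz (v := ![f 1, -f 0, 0])
    (by simp [Fin.sum_univ_three]; ring)
  obtain ⟨s', t', h'⟩ := exists_eq_of_syzygy hsyz (v := ![f 2, 0, -f 0])
    (by simp [Fin.sum_univ_three]; ring)
  intro h0
  have h1 := h 1
  have h2 := h 2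
  have h1' := h' 1
  have h2' := h' 2
  simp [cross_apply] at h0 h1 h2 h1' h2'
  apply mul_ne_zero (hf 0) (hf 0)
  linear_combination (s * t' - t * s') * h0 - f 0 * h1 + (s * P 1 + t * Q 1) * h2' -
    (s * P 2 + t * Q 2) * h1'

theorem eq_zero_of_combination_eq_zero [IsDomain R] (hf : ∀ i, f i ≠ 0)
    (hsyz : ∀ v : Fin 3 → R, (∑ i, v i * f i = 0) ↔ v ∈ Submodule.span R {P, Q})
    {a b : R} (h : ∀ i, a * P i + b * Q i = 0) : a = 0 ∧ b = 0 := by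
  have h0 := cross_ne_zero hf hsyz
  simp only [cross_apply, Matrix.cons_val_zero] at h0
  constructor <;> apply (mul_eq_zero.1 _).resolve_right h0
  · linear_combination Q 2 * h 1 - Q 1 * h 2
  · linear_combination P 1 * h 2 - P 2 * h 1

theorem isUnit_of_dvd_syzygies [IsDomain R] (hf : ∀ i, f i ≠ 0)
    (hsyz : ∀ v : Fin 3 → R, (∑ i, v i * f i = 0) ↔ v ∈ Submodule.span R {P, Q})
    {r : R} (hP : ∀ i, r ∣ P i) : IsUnit r := by
  choose v hv using hP
  have hr : r ≠ 0 := by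
    rintro rfl
    have := eq_zero_of_combination_eq_zero hf hsyz (a := 1) (b := 0) (fun i => by simp [hv])
    exact one_ne_zero this.1
  obtain ⟨s, t, h⟩ := exists_eq_of_syzygy hsyz (v := v)
    (sum_mul_eq_zero_of_dvd hr (by simp_rw [← hv]; exact left_syzygy hsyz))
  have := eq_zero_of_combination_eq_zero hf hsyz (a := 1 - r * s) (b := -(r * t))
    (fun i => by linear_combination hv i + r * h i)
  exact IsUnit.of_mul_eq_one s (sub_eq_zero.1 this.1).symm

theorem isUnit_of_dvd_cross [IsDomain R] (hf : ∀ i, f i ≠ 0)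
    (hsyz : ∀ v : Fin 3 → R, (∑ i, v i * f i = 0) ↔ v ∈ Submodule.span R {P, Q})
    {r : R} (hM : ∀ i, r ∣ crossProduct P Q i) : IsUnit r := by
  have hr : r ≠ 0 := by
    rintro rfl
    exact cross_ne_zero hf hsyz (zero_dvd_iff.1 (hM 0))
  refine isUnit_of_dvd_syzygies hf hsyz fun j => ?_
  have hdvd : ∀ i, r ∣ Q j * P i - P j * Q i := by
    have h0 := hM 0
    have h1 := hM 1
    have h2 := hM 2
    simp only [cross_apply, Matrix.cons_val] at h0 h1 h2
    intro i
    fin_cases i <;> fin_cases j <;> simp only [Fin.reduceFinMk, Fin.zero_eta, Fin.mk_one]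
    all_goals first
      | (ring_nf; exact dvd_zero _)
      | (convert h0 using 1; ring1)
      | (convert h1 using 1; ring1)
      | (convert h2 using 1; ring1)
      | (convert (dvd_neg.2 h0) using 1; ring1)
      | (convert (dvd_neg.2 h1) using 1; ring1)
      | (convert (dvd_neg.2 h2) using 1; ring1)
  choose v hv using hdvd
  obtain ⟨s, t, h⟩ := exists_eq_of_syzygy hsyz (v := v) (sum_mul_eq_zero_of_dvd hr (by
    simp_rw [← hv, sub_mul, mul_assoc, Finset.sum_sub_distrib, ← Finset.mul_sum,
      left_syzygy hsyz, right_syzygy hsyz, mul_zero, sub_zero]))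
  have := eq_zero_of_combination_eq_zero hf hsyz (a := Q j - r * s) (b := -(P j) - r * t)
    (fun i => by linear_combination hv i + r * h i)
  exact ⟨-t, by linear_combination -this.2⟩

theorem mul_cross_eq
    (hsyz : ∀ v : Fin 3 → R, (∑ i, v i * f i = 0) ↔ v ∈ Submodule.span R {P, Q}) (i : Fin 3) :
    f 0 * crossProduct P Q i = f i * crossProduct P Q 0 := by
  have hP := left_syzygy hsyz
  have hQ := right_syzygy hsyz
  simp only [Fin.sum_univ_three] at hP hQ
  fin_cases i <;> simp [cross_apply]
  · linear_combination P 2 * hQ - Q 2 * hP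
  · linear_combination Q 1 * hP - P 1 * hQ

theorem isRelPrime_gcd_cross [IsDomain R] (hf : ∀ i, f i ≠ 0)
    (hsyz : ∀ v : Fin 3 → R, (∑ i, v i * f i = 0) ↔ v ∈ Submodule.span R {P, Q})
    {c m n : R} (hm : c * m = crossProduct P Q 0) (hn : c * n = crossProduct P Q 1) :
    IsRelPrime c (crossProduct P Q 2) := by
  intro r hr hr2
  refine isUnit_of_dvd_cross hf hsyz (r := r) fun i => ?_
  fin_cases i
  · exact hm ▸ hr.mul_right m
  · exact hn ▸ hr.mul_right n
  · exact hr2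

/-- The Hilbert–Burch structure: the generators are a common multiple of the minors. -/
theorem exists_eq_mul_cross [IsDomain R] [UniqueFactorizationMonoid R] (hf : ∀ i, f i ≠ 0)
    (hsyz : ∀ v : Fin 3 → R, (∑ i, v i * f i = 0) ↔ v ∈ Submodule.span R {P, Q}) :
    ∃ u, u ≠ 0 ∧ ∀ i, f i = u * crossProduct P Q i := by
  have h0 := cross_ne_zero hf hsyz
  have key := mul_cross_eq hsyz
  obtain ⟨m, n, c, hmn, hm, hn⟩ :=
    UniqueFactorizationMonoid.exists_reduced_factors _ h0 (crossProduct P Q 1)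
  have hc := isRelPrime_gcd_cross hf hsyz hm hn
  have hc0 : c ≠ 0 := by rintro rfl; simp at hm; exact h0 hm.symm
  have h1 : m ∣ f 0 := by
    refine hmn.dvd_of_dvd_mul_right ⟨f 1, mul_left_cancel₀ hc0 ?_⟩
    linear_combination key 1 + f 0 * hn - f 1 * hm
  obtain ⟨g, hg⟩ := h1
  have hm0 : m ≠ 0 := by rintro rfl; simp at hm; exact h0 hm.symm
  obtain ⟨u, hu⟩ : c ∣ g := by
    refine hc.dvd_of_dvd_mul_right ⟨f 2, mul_left_cancel₀ hm0 ?_⟩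
    linear_combination key 2 - f 2 * hm - crossProduct P Q 2 * hg
  have hu' : f 0 = u * crossProduct P Q 0 := by rw [hg, hu, ← hm]; ring
  refine ⟨u, ?_, fun i => mul_right_cancel₀ h0 ?_⟩
  · rintro rfl; exact hf 0 (by simpa using hu')
  · rw [← key i, hu']; ring

theorem linForm_left_ne_zero [IsDomain R] (hf : ∀ i, f i ≠ 0)
    (hsyz : ∀ v : Fin 3 → R, (∑ i, v i * f i = 0) ↔ v ∈ Submodule.span R {P, Q}) :
    linForm P ≠ 0 := by
  intro h
  have := eq_zero_of_combination_eq_zero hf hsyz (a := 1) (b := 0)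
    (fun i => by simp [← coeff_linForm P, h])
  exact one_ne_zero this.1

theorem linForm_right_ne_zero [IsDomain R] (hf : ∀ i, f i ≠ 0)
    (hsyz : ∀ v : Fin 3 → R, (∑ i, v i * f i = 0) ↔ v ∈ Submodule.span R {P, Q}) :
    linForm Q ≠ 0 := by
  intro h
  have := eq_zero_of_combination_eq_zero hf hsyz (a := 0) (b := 1)
    (fun i => by simp [← coeff_linForm Q, h])
  exact one_ne_zero this.2

theorem isRelPrime_linForm [IsDomain R] (hf : ∀ i, f i ≠ 0)
    (hsyz : ∀ v : Fin 3 → R, (∑ i, v i * f i = 0) ↔ v ∈ Submodule.span R {P, Q}) :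
    IsRelPrime (linForm P) (linForm Q) := by
  have hP0 := linForm_left_ne_zero hf hsyz
  have hQ0 := linForm_right_ne_zero hf hsyz
  rintro c ⟨e, he⟩ ⟨e', he'⟩
  have hPd := (linForm_isHomogeneous P).totalDegree hP0
  have hQd := (linForm_isHomogeneous Q).totalDegree hQ0
  have h := he ▸ hP0
  have h' := he' ▸ hQ0
  rw [he, totalDegree_mul_of_isDomain (left_ne_zero_of_mul h) (right_ne_zero_of_mul h)] at hPd
  rw [he', totalDegree_mul_of_isDomain (left_ne_zero_of_mul h') (right_ne_zero_of_mul h')] at hQd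
  by_cases hc : c.totalDegree = 0
  · rw [totalDegree_eq_zero_iff_eq_C] at hc
    rw [hc]
    refine IsUnit.map C (isUnit_of_dvd_syzygies hf hsyz fun i => ?_)
    rw [← coeff_linForm P, he]
    exact (C_dvd_iff_dvd_coeff _ _).1 ⟨e, by rw [← hc]⟩ _
  · exfalso
    have h1 : e = C (e.coeff 0) := totalDegree_eq_zero_iff_eq_C.1 (by omega)
    have h2 : e' = C (e'.coeff 0) := totalDegree_eq_zero_iff_eq_C.1 (by omega)
    have := eq_zero_of_combination_eq_zero hf hsyz (a := e'.coeff 0) (b := -e.coeff 0)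
      (fun i => by
        rw [← coeff_linForm P, ← coeff_linForm Q, he, he', h1, h2, mul_comm c, mul_comm c,
          coeff_C_mul, coeff_C_mul]
        simp
        ring)
    rw [h2, this.1, C_0, mul_zero] at he'
    exact hQ0 he'

end Syzygies

section Descent

variable {K : Type*} [Field K] {f P Q : Fin 3 → MvPolynomial (Fin 3) K}

theorem mem_of_syzygies_mul_mem
    (hm : ∀ j, X j ∈ (Ideal.span (Set.range P ∪ Set.range Q)).radical)
    {a b : MvPolynomial (Fin 3) K} (hb : b ≠ 0) (hab : IsRelPrime a b)
    (w : MvPolynomial (Fin 3) (MvPolynomial (Fin 3) K))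
    (hP : linForm P * w ∈ Ideal.span {C a, C b}) (hQ : linForm Q * w ∈ Ideal.span {C a, C b}) :
    w ∈ Ideal.span {C a, C b} := by
  rw [span_C_pair, mem_map_C_iff] at hP hQ ⊢
  intro m
  set 𝔠 : Ideal (MvPolynomial (Fin 3) K) := Submodule.comap
    (LinearMap.toSpanSingleton (MvPolynomial (Fin 3) K) _ (coeff m w)) (Ideal.span {a, b}) with h𝔠
  have mem_𝔠 : ∀ r, r ∈ 𝔠 ↔ r * coeff m w ∈ Ideal.span {a, b} := fun r => by
    simp [h𝔠]
  have hle : Ideal.span (Set.range P ∪ Set.range Q) ≤ 𝔠.radical := by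
    rw [Ideal.span_le]
    rintro _ (⟨i, rfl⟩ | ⟨i, rfl⟩)
    · exact ⟨w.totalDegree + 1,
        (mem_𝔠 _).2 (pow_mul_coeff_mem _ P w hP i _ m (by omega))⟩
    · exact ⟨w.totalDegree + 1,
        (mem_𝔠 _).2 (pow_mul_coeff_mem _ Q w hQ i _ m (by omega))⟩
  have hX : ∀ j, ∃ n : ℕ, (X j : MvPolynomial (Fin 3) K) ^ n ∈ 𝔠 := fun j => by
    have := Ideal.radical_mono hle (hm j)
    rwa [Ideal.radical_idem] at this
  choose n hn using hX
  refine mem_span_pair_of_X_pow_mul_mem hb hab (∑ j, n j) fun j => (mem_𝔠 _).1 ?_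
  exact Ideal.pow_mem_of_pow_mem _ (hn j) (Finset.single_le_sum (fun _ _ => Nat.zero_le _)
    (Finset.mem_univ j))

theorem mem_of_isRelPrime_mul_mem (hf : ∀ i, f i ≠ 0)
    (hsyz : ∀ v : Fin 3 → MvPolynomial (Fin 3) K,
      (∑ i, v i * f i = 0) ↔ v ∈ Submodule.span (MvPolynomial (Fin 3) K) {P, Q})
    (hm : ∀ j, X j ∈ (Ideal.span (Set.range P ∪ Set.range Q)).radical)
    {a b : MvPolynomial (Fin 3) K} (ha : a ≠ 0) (hb : b ≠ 0) (hab : IsRelPrime a b)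
    {F : MvPolynomial (Fin 3) (MvPolynomial (Fin 3) K)}
    (h₁ : C a * F ∈ Ideal.span {linForm P, linForm Q})
    (h₂ : C b * F ∈ Ideal.span {linForm P, linForm Q}) :
    F ∈ Ideal.span {linForm P, linForm Q} := by
  obtain ⟨u₁, v₁, h₁⟩ := Ideal.mem_span_pair.1 h₁
  obtain ⟨u₂, v₂, h₂⟩ := Ideal.mem_span_pair.1 h₂
  have h₁' : C a * F = linForm P * u₁ + linForm Q * v₁ := by linear_combination -h₁
  have h₂' : C b * F = linForm P * u₂ + linForm Q * v₂ := by linear_combination -h₂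
  have hQ0 := linForm_right_ne_zero hf hsyz
  obtain ⟨w, hu, hv⟩ := exists_koszul_quotient hQ0 (isRelPrime_linForm hf hsyz) h₁' h₂'
  refine mem_span_pair_of_koszul_quotient (C_ne_zero.2 ha) (isRelPrime_C ha hab) h₁' hu hv
    (mem_of_syzygies_mul_mem hm hb hab w ?_ ?_)
  · exact Ideal.mem_span_pair.2 ⟨v₂, -v₁, by linear_combination -hv⟩
  · exact Ideal.mem_span_pair.2 ⟨-u₂, u₁, by linear_combination hu⟩

theorem mem_of_cross_pow_mul_mem (hf : ∀ i, f i ≠ 0)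
    (hsyz : ∀ v : Fin 3 → MvPolynomial (Fin 3) K,
      (∑ i, v i * f i = 0) ↔ v ∈ Submodule.span (MvPolynomial (Fin 3) K) {P, Q})
    (hm : ∀ j, X j ∈ (Ideal.span (Set.range P ∪ Set.range Q)).radical) (k : ℕ)
    {F : MvPolynomial (Fin 3) (MvPolynomial (Fin 3) K)}
    (h : ∀ i, C (crossProduct P Q i) ^ k * F ∈ Ideal.span {linForm P, linForm Q}) :
    F ∈ Ideal.span {linForm P, linForm Q} := by
  obtain ⟨u, -, hu⟩ := exists_eq_mul_cross hf hsyz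
  have hM : ∀ i, crossProduct P Q i ≠ 0 := fun i h => hf i (by rw [hu, h, mul_zero])
  obtain ⟨m, n, c, hmn, hm', hn'⟩ :=
    UniqueFactorizationMonoid.exists_reduced_factors _ (hM 0) (crossProduct P Q 1)
  have h0 := hM 0
  have h1 := hM 1
  rw [← hm'] at h0
  rw [← hn'] at h1
  have hc := left_ne_zero_of_mul h0
  refine mem_of_isRelPrime_mul_mem hf hsyz hm (pow_ne_zero k hc) (pow_ne_zero k (hM 2))
    (isRelPrime_pow_pow (isRelPrime_gcd_cross hf hsyz hm' hn') k k) ?_ (by simpa using h 2)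
  refine mem_of_isRelPrime_mul_mem hf hsyz hm (pow_ne_zero k (right_ne_zero_of_mul h0))
    (pow_ne_zero k (right_ne_zero_of_mul h1)) (isRelPrime_pow_pow hmn k k) ?_ ?_
  · convert h 0 using 1
    rw [← hm']; simp; ring
  · convert h 1 using 1
    rw [← hn']; simp; ring

end Descent

section Points

variable {K : Type*} [Field K]

theorem exists_isHomogeneous_separating {n : ℕ} {p q : Fin n → K} (hq : q ≠ 0)
    (hpq : ∀ t : K, p ≠ t • q) :
    ∃ l : MvPolynomial (Fin n) K, l.IsHomogeneous 1 ∧ eval q l = 0 ∧ eval p l ≠ 0 := by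
  obtain ⟨a, ha⟩ := Function.ne_iff.1 hq
  by_contra! H
  refine hpq (p a / q a) (funext fun b => ?_)
  have := H (C (q a) * X b - C (q b) * X a)
    ((isHomogeneous_C_mul_X _ _).sub (isHomogeneous_C_mul_X _ _)) (by simp [mul_comm])
  simp at this ha
  simp
  field_simp
  linear_combination this

/-- A point of a reduced finite set of points is a simple zero of some form in the ideal. -/
theorem exists_mem_pderiv_ne_zero {N n : ℕ} (p : Fin (n + 1) → (Fin (N + 2) → K))
    (h0 : ∀ i, p i ≠ 0) (hp : ∀ i j, i ≠ j → ∀ t : K, p i ≠ t • p j) (i : Fin (n + 1)) :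
    ∃ g ∈ ⨅ i, pointIdeal (p i), ∃ b, eval (p i) (pderiv b g) ≠ 0 := by
  classical
  have hl : ∀ j, ∃ l : MvPolynomial (Fin (N + 2)) K, l.IsHomogeneous 1 ∧
      (j ≠ i → eval (p j) l = 0) ∧ eval (p i) l ≠ 0 := by
    intro j
    by_cases hj : j = i
    · obtain ⟨a, ha⟩ := Function.ne_iff.1 (h0 i)
      exact ⟨X a, isHomogeneous_X _ _, fun h => absurd hj h, by simpa using ha⟩
    · obtain ⟨l, h1, h2, h3⟩ := exists_isHomogeneous_separating (h0 j) (hp i j (Ne.symm hj))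
      exact ⟨l, h1, fun _ => h2, h3⟩
  choose l hl1 hl2 hl3 using hl
  obtain ⟨a, ha⟩ := Function.ne_iff.1 (h0 i)
  obtain ⟨b, hb⟩ := exists_ne a
  have hℓ : (C (p i a) * X b - C (p i b) * X a : MvPolynomial (Fin (N + 2)) K).IsHomogeneous 1 :=
    (isHomogeneous_C_mul_X _ _).sub (isHomogeneous_C_mul_X _ _)
  have hℓ0 : eval (p i) (C (p i a) * X b - C (p i b) * X a) = 0 := by simp [mul_comm]
  refine ⟨(C (p i a) * X b - C (p i b) * X a) * ∏ j ∈ Finset.univ.erase i, l j, ?_, b, ?_⟩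
  · rw [Submodule.mem_iInf]
    intro j
    refine Ideal.subset_span
      ⟨⟨_, hℓ.mul (IsHomogeneous.prod _ _ (fun _ => 1) fun j _ => hl1 j)⟩, ?_⟩
    rw [map_mul]
    by_cases hj : j = i
    · rw [hj, hℓ0, zero_mul]
    · rw [map_prod, Finset.prod_eq_zero (Finset.mem_erase.2 ⟨hj, Finset.mem_univ j⟩) (hl2 j hj),
        mul_zero]
  · rw [Derivation.leibniz, map_add, smul_eq_mul, smul_eq_mul, map_mul, map_mul, hℓ0, zero_mul,
      zero_add, map_prod]
    refine mul_ne_zero (Finset.prod_ne_zero_iff.2 fun j _ => hl3 j) ?_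
    simpa [pderiv_X_of_ne hb.symm] using ha

theorem X_mem_of_pointIdeal_le {n d : ℕ} {p : Fin n → K} (hp : p ≠ 0)
    {𝔭 : Ideal (MvPolynomial (Fin n) K)} [𝔭.IsPrime] (hle : pointIdeal p ≤ 𝔭)
    {g : MvPolynomial (Fin n) K} (hg : g.IsHomogeneous d) (hgp : eval p g ≠ 0) (hmem : g ∈ 𝔭)
    (b : Fin n) : X b ∈ 𝔭 := by
  obtain ⟨a, ha⟩ := Function.ne_iff.1 hp
  have hC : ∀ {c : K} {h : MvPolynomial (Fin n) K}, c ≠ 0 → C c * h ∈ 𝔭 → h ∈ 𝔭 := by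
    intro c h hc hch
    have := 𝔭.mul_mem_left (C c⁻¹) hch
    rwa [← mul_assoc, ← C_mul, inv_mul_cancel₀ hc, C_1, one_mul] at this
  have h1 : C (p a ^ d) * g - C (eval p g) * X a ^ d ∈ 𝔭 :=
    hle (Ideal.subset_span ⟨⟨d, (hg.C_mul _).sub (isHomogeneous_C_mul_X_pow _ _ _)⟩,
      by simp [mul_comm]⟩)
  have h2 : X a ∈ 𝔭 := Ideal.IsPrime.mem_of_pow_mem ‹_› d
    (hC hgp ((Submodule.sub_mem_iff_right _ (𝔭.mul_mem_left _ hmem)).1 h1))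
  have h3 : C (p a) * X b - C (p b) * X a ∈ 𝔭 :=
    hle (Ideal.subset_span ⟨⟨1, (isHomogeneous_C_mul_X _ _).sub (isHomogeneous_C_mul_X _ _)⟩,
      by simp [mul_comm]⟩)
  exact hC ha ((Submodule.sub_mem_iff_left _ (𝔭.mul_mem_left _ h2)).1 h3)

theorem eval_pderiv_eq_zero_of_mem_span {ι σ : Type*} {f : ι → MvPolynomial σ K} {p : σ → K}
    (h0 : ∀ i, eval p (f i) = 0) {b : σ} (h1 : ∀ i, eval p (pderiv b (f i)) = 0)
    {g : MvPolynomial σ K} (hg : g ∈ Ideal.span (Set.range f)) : eval p (pderiv b g) = 0 := by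
  suffices eval p g = 0 ∧ eval p (pderiv b g) = 0 from this.2
  induction hg using Submodule.span_induction with
  | mem x hx => obtain ⟨i, rfl⟩ := hx; exact ⟨h0 i, h1 i⟩
  | zero => simp
  | add x y _ _ hx hy => simp [hx, hy]
  | smul a x _ hx => simp [hx, Derivation.leibniz]

/-- The ideal of a reduced set of points is generically a complete intersection: the entries of
the Hilbert–Burch matrix vanish simultaneously at no point of the projective plane. -/
theorem X_mem_radical_of_definesReducedPoints {I : Ideal (MvPolynomial (Fin 3) K)}
    {f P Q : Fin 3 → MvPolynomial (Fin 3) K} {d₀ d₁ : ℕ}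
    (hpts : @DefinesReducedPoints K _ 2 I) (hgen : I = Ideal.span (Set.range f))
    (hP : ∀ i, (P i).IsHomogeneous d₀) (hQ : ∀ i, (Q i).IsHomogeneous d₁)
    {u : MvPolynomial (Fin 3) K} (hf : ∀ i, f i = u * crossProduct P Q i) (j : Fin 3) :
    X j ∈ (Ideal.span (Set.range P ∪ Set.range Q)).radical := by
  obtain ⟨n, p, h0, hp, hI⟩ := hpts
  rw [Ideal.radical_eq_sInf, Ideal.mem_sInf]
  rintro 𝔭 ⟨hle, h𝔭⟩
  have hP𝔭 : ∀ i, P i ∈ 𝔭 := fun i => hle (Ideal.subset_span (Or.inl ⟨i, rfl⟩))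
  have hQ𝔭 : ∀ i, Q i ∈ 𝔭 := fun i => hle (Ideal.subset_span (Or.inr ⟨i, rfl⟩))
  have hI𝔭 : ⨅ i, pointIdeal (p i) ≤ 𝔭 := by
    rw [← hI, hgen, Ideal.span_le]
    rintro _ ⟨i, rfl⟩
    rw [SetLike.mem_coe, hf]
    refine 𝔭.mul_mem_left _ ?_
    fin_cases i <;> simp only [cross_apply] <;>
    exact 𝔭.sub_mem (𝔭.mul_mem_right _ (hP𝔭 _)) (𝔭.mul_mem_right _ (hP𝔭 _))
  rw [← Finset.inf_univ_eq_iInf, h𝔭.inf_le'] at hI𝔭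
  obtain ⟨i, -, hi⟩ := hI𝔭
  by_cases hPi : ∃ k, eval (p i) (P k) ≠ 0
  · obtain ⟨k, hk⟩ := hPi
    exact X_mem_of_pointIdeal_le (h0 i) hi (hP k) hk (hP𝔭 k) j
  by_cases hQi : ∃ k, eval (p i) (Q k) ≠ 0
  · obtain ⟨k, hk⟩ := hQi
    exact X_mem_of_pointIdeal_le (h0 i) hi (hQ k) hk (hQ𝔭 k) j
  push Not at hPi hQi
  exfalso
  obtain ⟨g, hg, b, hb⟩ := exists_mem_pderiv_ne_zero p h0 hp i
  rw [← hI, hgen] at hg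
  refine hb (eval_pderiv_eq_zero_of_mem_span (fun k => ?_) (fun k => ?_) hg)
  · rw [hf]
    fin_cases k <;> simp [cross_apply, hPi, hQi]
  · rw [hf]
    fin_cases k <;> simp [cross_apply, hPi, hQi, Derivation.leibniz]

end Points

section Encoding

variable {R : Type*} [CommRing R] {ι : Type*} [Fintype ι]

/-- The polynomial with coefficient `v q` at the monomial with multiset of variables `e q`. -/
def polyOfCoeff (e : ι → Multiset (Fin 3)) : (ι → R) →ₗ[R] MvPolynomial (Fin 3) R :=
  ∑ q, monomial (Multiset.toFinsupp (e q)) ∘ₗ LinearMap.proj q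

theorem polyOfCoeff_apply (e : ι → Multiset (Fin 3)) (v : ι → R) :
    polyOfCoeff e v = ∑ q, monomial (Multiset.toFinsupp (e q)) (v q) := by
  simp [polyOfCoeff]

theorem coeff_polyOfCoeff {e : ι → Multiset (Fin 3)} (he : Function.Injective e) (v : ι → R)
    (q : ι) : coeff (Multiset.toFinsupp (e q)) (polyOfCoeff e v) = v q := by
  classical
  simp [polyOfCoeff_apply, coeff_sum, coeff_monomial, he.eq_iff]

theorem polyOfCoeff_injective {e : ι → Multiset (Fin 3)} (he : Function.Injective e) :
    Function.Injective (polyOfCoeff (R := R) e) := fun v w h => funext fun q => by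
  rw [← coeff_polyOfCoeff he v, h, coeff_polyOfCoeff he]

theorem polyOfCoeff_isHomogeneous {e : ι → Multiset (Fin 3)} {n : ℕ}
    (hn : ∀ q, (e q).card = n) (v : ι → R) : (polyOfCoeff e v).IsHomogeneous n := by
  rw [polyOfCoeff_apply]
  refine IsHomogeneous.sum _ _ _ fun q _ => isHomogeneous_monomial _ ?_
  rw [← hn q, ← congrArg Multiset.card (Multiset.toFinsupp_toMultiset (e q)),
    Finsupp.card_toMultiset]
  rfl

theorem exists_polyOfCoeff_eq {e : ι → Multiset (Fin 3)} (he : Function.Injective e) {n : ℕ}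
    (hn : ∀ q, (e q).card = n) (hs : ∀ s : Multiset (Fin 3), s.card = n → ∃ q, e q = s)
    {F : MvPolynomial (Fin 3) R} (hF : F.IsHomogeneous n) : ∃ v, polyOfCoeff e v = F := by
  refine ⟨fun q => coeff (Multiset.toFinsupp (e q)) F, ?_⟩
  ext m
  by_cases hm : m.degree = n
  · obtain ⟨q, hq⟩ := hs (Finsupp.toMultiset m) (by rw [Finsupp.card_toMultiset, ← hm]; rfl)
    have : m = Multiset.toFinsupp (e q) := by rw [hq, Finsupp.toMultiset_toFinsupp]
    rw [this, coeff_polyOfCoeff he]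
  · rw [(polyOfCoeff_isHomogeneous hn _).coeff_eq_zero hm, hF.coeff_eq_zero hm]

theorem polyOfCoeff_indicator {e : ι → Multiset (Fin 3)} (he : Function.Injective e) {q : ι}
    {s : Multiset (Fin 3)} (hq : e q = s) :
    polyOfCoeff e (fun q => if s = e q then (1 : R) else 0) =
      monomial (Multiset.toFinsupp s) 1 := by
  classical
  subst hq
  simp [polyOfCoeff_apply, he.eq_iff, apply_ite, Finset.sum_ite_eq]

/-- The variables of a quadratic monomial. -/
def SymPair.vars (q : SymPair) : Multiset (Fin 3) := {q.val.1, q.val.2}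

/-- The variables of a cubic monomial. -/
def SymTriple.vars (q : SymTriple) : Multiset (Fin 3) := {q.val.1, q.val.2.1, q.val.2.2}

theorem singleton_injective : Function.Injective fun i : Fin 3 => ({i} : Multiset (Fin 3)) :=
  fun _ _ h => Multiset.singleton_inj.1 h

theorem SymPair.vars_injective : Function.Injective SymPair.vars := by
  unfold Function.Injective SymPair.vars; decide

theorem SymTriple.vars_injective : Function.Injective SymTriple.vars := by
  unfold Function.Injective SymTriple.vars; decide

theorem exists_symPair_vars_eq (i j : Fin 3) : ∃ q : SymPair, q.vars = {i, j} := by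
  revert i j; unfold SymPair.vars; decide

theorem exists_symTriple_vars_eq (i j k : Fin 3) : ∃ q : SymTriple, q.vars = {i, j, k} := by
  revert i j k; unfold SymTriple.vars; decide

theorem polyOfCoeff_symE (i j : Fin 3) :
    polyOfCoeff SymPair.vars (symE i j) = (X i * X j : MvPolynomial (Fin 3) R) := by
  have h : (symE i j : SymPair → R) = fun q => if {i, j} = q.vars then 1 else 0 := by
    funext q
    have : (q.val = (i, j) ∨ q.val = (j, i)) ↔ {i, j} = q.vars := by
      revert i j q; unfold SymPair.vars; decide
    simp only [symE, this]
  obtain ⟨q, hq⟩ := exists_symPair_vars_eq i j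
  rw [h, polyOfCoeff_indicator SymPair.vars_injective hq]
  simp [X, monomial_mul, Multiset.insert_eq_cons, ← Multiset.singleton_add]

theorem polyOfCoeff_symE3 (i j k : Fin 3) :
    polyOfCoeff SymTriple.vars (symE3 i j k) = (X i * (X j * X k) : MvPolynomial (Fin 3) R) := by
  obtain ⟨q, hq⟩ := exists_symTriple_vars_eq i j k
  have h : (symE3 i j k : SymTriple → R) = fun q => if {i, j, k} = q.vars then 1 else 0 := rfl
  rw [h, polyOfCoeff_indicator SymTriple.vars_injective hq]
  simp [X, monomial_mul, Multiset.insert_eq_cons, ← Multiset.singleton_add]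

theorem polyOfCoeff_singleton_apply (v : Fin 3 → R) :
    polyOfCoeff (fun i => {i}) v = ∑ k, C (v k) * X k := by
  simp [polyOfCoeff_apply, X, C_mul_monomial]

theorem polyOfCoeff_symPair_apply (v : SymPair → R) :
    polyOfCoeff SymPair.vars v = ∑ q, C (v q) * (X q.val.1 * X q.val.2) := by
  simp [polyOfCoeff_apply, X, monomial_mul, C_mul_monomial, SymPair.vars,
    Multiset.insert_eq_cons, ← Multiset.singleton_add]

theorem polyOfCoeff_symTriple_apply (v : SymTriple → R) :
    polyOfCoeff SymTriple.vars v =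
      ∑ q, C (v q) * (X q.val.1 * (X q.val.2.1 * X q.val.2.2)) := by
  simp [polyOfCoeff_apply, X, monomial_mul, C_mul_monomial, SymTriple.vars,
    Multiset.insert_eq_cons, ← Multiset.singleton_add]

theorem polyOfCoeff_symPair_isHomogeneous (v : SymPair → R) :
    (polyOfCoeff SymPair.vars v).IsHomogeneous 2 :=
  polyOfCoeff_isHomogeneous (fun _ => Multiset.card_pair _ _) v

theorem polyOfCoeff_symTriple_isHomogeneous (v : SymTriple → R) :
    (polyOfCoeff SymTriple.vars v).IsHomogeneous 3 :=
  polyOfCoeff_isHomogeneous (fun _ => by simp [SymTriple.vars]) v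

theorem polyOfCoeff_sum_smul_symE (P x : Fin 3 → R) :
    polyOfCoeff SymPair.vars (∑ k, x k • ∑ j, P j • symE j k) =
      linForm P * polyOfCoeff (fun i => {i}) x := by
  simp only [map_sum, map_smul, polyOfCoeff_symE, polyOfCoeff_singleton_apply, linForm,
    smul_eq_C_mul, Finset.mul_sum, Finset.sum_mul]
  rw [Finset.sum_congr rfl fun k _ => Finset.sum_congr rfl fun j _ => ?_]
  ring

theorem polyOfCoeff_first_map_inl (P Q x : Fin 3 → R) :
    polyOfCoeff SymPair.vars (fun q => (Pi.basisFun R (Fin 3)).constr ℕ (fun k =>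
      Sum.elim (-∑ j, Q j • symE j k) (∑ j, P j • symE j k) : Fin 3 → SymPair ⊕ SymPair → R)
        x (Sum.inl q)) = -(linForm Q * polyOfCoeff (fun i => {i}) x) := by
  rw [← polyOfCoeff_sum_smul_symE, ← map_neg]
  congr 1
  funext q
  simp [Module.Basis.constr_apply_fintype]

theorem polyOfCoeff_first_map_inr (P Q x : Fin 3 → R) :
    polyOfCoeff SymPair.vars (fun q => (Pi.basisFun R (Fin 3)).constr ℕ (fun k =>
      Sum.elim (-∑ j, Q j • symE j k) (∑ j, P j • symE j k) : Fin 3 → SymPair ⊕ SymPair → R)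
        x (Sum.inr q)) = linForm P * polyOfCoeff (fun i => {i}) x := by
  rw [← polyOfCoeff_sum_smul_symE]
  congr 1
  funext q
  simp [Module.Basis.constr_apply_fintype]

theorem polyOfCoeff_sum_smul_symE3 (P : Fin 3 → R) (y : SymPair → R) :
    polyOfCoeff SymTriple.vars (∑ q, y q • ∑ i, P i • symE3 i q.val.1 q.val.2) =
      linForm P * polyOfCoeff SymPair.vars y := by
  rw [polyOfCoeff_symPair_apply, map_sum, Finset.mul_sum]
  refine Finset.sum_congr rfl fun q _ => ?_
  simp only [map_sum, map_smul, polyOfCoeff_symE3, linForm, smul_eq_C_mul, Finset.mul_sum,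
    Finset.sum_mul]
  refine Finset.sum_congr rfl fun i _ => ?_
  ring

theorem polyOfCoeff_middle_map (P Q : Fin 3 → R) (y : SymPair ⊕ SymPair → R) :
    polyOfCoeff SymTriple.vars ((Pi.basisFun R (SymPair ⊕ SymPair)).constr ℕ
      (Sum.elim (fun q => ∑ i, P i • symE3 i q.val.1 q.val.2)
        fun q => ∑ i, Q i • symE3 i q.val.1 q.val.2) y) =
      linForm P * polyOfCoeff SymPair.vars (fun q => y (Sum.inl q)) +
        linForm Q * polyOfCoeff SymPair.vars (fun q => y (Sum.inr q)) := by
  rw [← polyOfCoeff_sum_smul_symE3, ← polyOfCoeff_sum_smul_symE3, ← map_add,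
    Module.Basis.constr_apply_fintype, Fintype.sum_sum_type]
  rfl

theorem last_map_eq_eval (f : Fin 3 → R) (v : SymTriple → R) :
    (Pi.basisFun R SymTriple).constr ℕ
      (fun q => f q.val.1 * f q.val.2.1 * f q.val.2.2) v =
      eval f (polyOfCoeff SymTriple.vars v) := by
  simp [Module.Basis.constr_apply_fintype, polyOfCoeff_symTriple_apply, mul_assoc]

theorem exists_linear_eq {F : MvPolynomial (Fin 3) R} (hF : F.IsHomogeneous 1) :
    ∃ v, polyOfCoeff (fun i => {i}) v = F :=
  exists_polyOfCoeff_eq singleton_injective (fun _ => Multiset.card_singleton _)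
    (fun s hs => by
      obtain ⟨a, rfl⟩ := Multiset.card_eq_one.1 hs
      exact ⟨a, rfl⟩) hF

theorem exists_quadratic_eq {F : MvPolynomial (Fin 3) R} (hF : F.IsHomogeneous 2) :
    ∃ v, polyOfCoeff SymPair.vars v = F :=
  exists_polyOfCoeff_eq SymPair.vars_injective (fun _ => Multiset.card_pair _ _)
    (fun s hs => by
      obtain ⟨a, b, rfl⟩ := Multiset.card_eq_two.1 hs
      exact exists_symPair_vars_eq a b) hF

theorem exists_cubic_eq {F : MvPolynomial (Fin 3) R} (hF : F.IsHomogeneous 3) :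
    ∃ v, polyOfCoeff SymTriple.vars v = F :=
  exists_polyOfCoeff_eq SymTriple.vars_injective (fun _ => rfl)
    (fun s hs => by
      obtain ⟨a, b, c, rfl⟩ := Multiset.card_eq_three.1 hs
      exact exists_symTriple_vars_eq a b c) hF

theorem homogeneousComponent_mul_left {p : MvPolynomial (Fin 3) R} {k : ℕ}
    (hp : p.IsHomogeneous k) (n : ℕ) (u : MvPolynomial (Fin 3) R) :
    homogeneousComponent (k + n) (p * u) = p * homogeneousComponent n u := by
  conv_lhs => rw [← sum_homogeneousComponent u, Finset.mul_sum, map_sum]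
  have h : ∀ i, homogeneousComponent (k + n) (p * homogeneousComponent i u) =
      if n = i then p * homogeneousComponent i u else 0 := fun i => by
    rw [homogeneousComponent_of_mem (hp.mul (homogeneousComponent_isHomogeneous i u))]
    simp
  simp only [h, Finset.sum_ite_eq, Finset.mem_range]
  split_ifs with hn
  · rfl
  · rw [homogeneousComponent_eq_zero n u (by omega), mul_zero]

theorem cross_mul_X_sub_mem (P Q : Fin 3 → R) (i j : Fin 3) :
    C (crossProduct P Q i) * X j - C (crossProduct P Q j) * X i ∈
      Ideal.span {linForm P, linForm Q} := by
  have key : ∀ i : Fin 3, C (crossProduct P Q i) * X (i + 1) - C (crossProduct P Q (i + 1)) * X i ∈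
      Ideal.span {linForm P, linForm Q} := fun i => by
    refine Ideal.mem_span_pair.2 ⟨C (Q (i + 2)), -C (P (i + 2)), ?_⟩
    fin_cases i <;> simp [linForm, Fin.sum_univ_three, cross_apply] <;> ring
  have key' : ∀ i : Fin 3, C (crossProduct P Q (i + 1)) * X i - C (crossProduct P Q i) * X (i + 1) ∈
      Ideal.span {linForm P, linForm Q} := fun i => by
    rw [← neg_sub]; exact neg_mem (key i)
  fin_cases i <;> fin_cases j
  · simp
  · exact key 0
  · exact key' 2
  · exact key' 0
  · simp
  · exact key 1
  · exact key 2
  · exact key' 1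
  · simp

theorem cross_pow_mul_mem (P Q : Fin 3 → R) (v : SymTriple → R)
    (h : ∑ q : SymTriple, v q * (crossProduct P Q q.val.1 *
      (crossProduct P Q q.val.2.1 * crossProduct P Q q.val.2.2)) = 0) (l : Fin 3) :
    C (crossProduct P Q l) ^ 3 * polyOfCoeff SymTriple.vars v ∈
      Ideal.span {linForm P, linForm Q} := by
  set π := Ideal.Quotient.mk (Ideal.span {linForm P, linForm Q}) with hπ
  have hM : ∀ i, π (C (crossProduct P Q l)) * π (X i) = π (C (crossProduct P Q i)) * π (X l) :=
    fun i => by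
      rw [← map_mul, ← map_mul, hπ, Ideal.Quotient.eq]
      exact cross_mul_X_sub_mem P Q l i
  rw [← Ideal.Quotient.eq_zero_iff_mem, ← hπ]
  calc π (C (crossProduct P Q l) ^ 3 * polyOfCoeff SymTriple.vars v)
      = π (X l ^ 3 * C (∑ q : SymTriple, v q * (crossProduct P Q q.val.1 *
          (crossProduct P Q q.val.2.1 * crossProduct P Q q.val.2.2)))) := by
        rw [polyOfCoeff_symTriple_apply, Finset.mul_sum, map_sum C, Finset.mul_sum, map_sum,
          map_sum]
        refine Finset.sum_congr rfl fun q _ => ?_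
        simp only [map_mul, map_pow]
        generalize hx : π (C (crossProduct P Q l)) = m at hM
        have h1 := hM q.val.1
        have h2 := hM q.val.2.1
        have h3 := hM q.val.2.2
        calc _ = π (C (v q)) * ((m * π (X q.val.1)) * (m * π (X q.val.2.1)) *
                (m * π (X q.val.2.2))) := by ring
          _ = _ := by rw [h1, h2, h3]; ring
    _ = 0 := by rw [h, C_0, mul_zero, map_zero]

end Encoding

section Minimality

variable {K : Type*} [Field K]

theorem mem_irrelevant_of_isHomogeneous {g : MvPolynomial (Fin 3) K} {n : ℕ}
    (hg : g.IsHomogeneous n) (hn : n ≠ 0) :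
    g ∈ Ideal.span {(X 0 : MvPolynomial (Fin 3) K), X 1, X 2} := by
  have hs : ({X 0, X 1, X 2} : Set (MvPolynomial (Fin 3) K)) = X '' Set.univ := by
    ext x
    simp [Fin.exists_fin_succ, eq_comm]
  rw [hs, mem_ideal_span_X_image]
  intro m hm
  by_contra! h
  have hm0 : m = 0 := by
    ext i
    exact h i (Set.mem_univ i)
  have := hg (mem_support_iff.1 hm)
  simp [hm0] at this
  exact hn this.symm

theorem mem_irrelevant_of_syzygy {f P : Fin 3 → MvPolynomial (Fin 3) K} {n : ℕ}
    (hmin : ∀ i, f i ∉ Ideal.span (f '' {j | j ≠ i}))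
    (hP : ∀ i, (P i).IsHomogeneous n) (h : ∑ i, P i * f i = 0) (i : Fin 3) :
    P i ∈ Ideal.span {(X 0 : MvPolynomial (Fin 3) K), X 1, X 2} := by
  by_cases hn : n = 0
  · subst hn
    suffices P i = 0 by rw [this]; exact zero_mem _
    by_contra h0
    have hC : P i = C (coeff 0 (P i)) :=
      totalDegree_eq_zero_iff_eq_C.1 ((totalDegree_zero_iff_isHomogeneous _).2 (hP i))
    have hc : coeff 0 (P i) ≠ 0 := fun hc => h0 (by rw [hC, hc, C_0])
    refine hmin i ?_
    rw [← Finset.add_sum_erase _ _ (Finset.mem_univ i)] at h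
    have hfi : f i = -(C (coeff 0 (P i))⁻¹ * ∑ j ∈ Finset.univ.erase i, P j * f j) := by
      have h1 : C (coeff 0 (P i))⁻¹ * P i = 1 := by
        conv_lhs => rw [hC]
        simp [← C_mul, hc]
      linear_combination C (coeff 0 (P i))⁻¹ * h - f i * h1
    rw [hfi]
    refine neg_mem (Ideal.mul_mem_left _ _ (sum_mem fun j hj => Ideal.mul_mem_left _ _
      (Ideal.subset_span ⟨j, Finset.ne_of_mem_erase hj, rfl⟩)))
  · exact mem_irrelevant_of_isHomogeneous (hP i) hn

end Minimality

/-- the minimal free resolution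
`0 → R(−4d)³ → R(−3d−d₀)⁶ ⊕ R(−3d−d₁)⁶ → R(−3d)¹⁰ → I³ → 0`
of the cube of a strict almost complete intersection ideal of points in `P²`,
uniformly generated in degree `d`: the displayed sequence of maps is exact, the
last map `e_{ijk} ↦ f_i f_j f_k` has image `I³`, and the resolution is minimal
(the matrix entries `±P_i`, `±Q_i` lie in the irrelevant ideal); the first map
is the one given (up to signs and reordering of summands) by the matrix `Y`. -/
theorem resolution_of_cube {K : Type*} [Field K]
    (I : Ideal (MvPolynomial (Fin 3) K))
    (f P Q : Fin 3 → MvPolynomial (Fin 3) K) (d d₀ d₁ : ℕ)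
    (hpts : @DefinesReducedPoints K _ 2 I)
    (hgen : I = Ideal.span (Set.range f))
    (hmin : ∀ i, f i ∉ Ideal.span (f '' {j | j ≠ i}))
    (hdeg : ∀ i, (f i).IsHomogeneous d)
    (hP : ∀ i, (P i).IsHomogeneous d₀)
    (hQ : ∀ i, (Q i).IsHomogeneous d₁)
    (hd : d₀ + d₁ = d)
    (hsyz : ∀ v : Fin 3 → MvPolynomial (Fin 3) K,
      (∑ i, v i * f i = 0) ↔
        v ∈ Submodule.span (MvPolynomial (Fin 3) K) {P, Q}) :
    let R := MvPolynomial (Fin 3) K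
    -- first map: (k-th basis vector) ↦ (−Σⱼ Qⱼ e⁽¹⁾_{jk}, Σⱼ Pⱼ e⁽²⁾_{jk})
    let α : (Fin 3 → R) →ₗ[R] (SymPair ⊕ SymPair → R) :=
      (Pi.basisFun R (Fin 3)).constr ℕ fun k =>
        Sum.elim (-∑ j, Q j • symE j k) (∑ j, P j • symE j k)
    -- middle map: (first summand) (j,k) ↦ Σᵢ Pᵢ e_{ijk},
    --             (second summand) (j,k) ↦ Σᵢ Qᵢ e_{ijk}
    let β : (SymPair ⊕ SymPair → R) →ₗ[R] (SymTriple → R) :=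
      (Pi.basisFun R (SymPair ⊕ SymPair)).constr ℕ
        (Sum.elim (fun q => ∑ i, P i • symE3 i q.val.1 q.val.2)
          fun q => ∑ i, Q i • symE3 i q.val.1 q.val.2)
    -- last map: e_{ijk} ↦ f_i f_j f_k (with image I³)
    let γ : (SymTriple → R) →ₗ[R] R :=
      (Pi.basisFun R SymTriple).constr ℕ fun q =>
        f q.val.1 * f q.val.2.1 * f q.val.2.2
    Function.Injective α ∧
      LinearMap.range α = LinearMap.ker β ∧
      LinearMap.range β = LinearMap.ker γ ∧
      LinearMap.range γ = (I ^ 3 : Ideal R) ∧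
      (∀ i, P i ∈ Ideal.span {(X 0 : MvPolynomial (Fin 3) K), X 1, X 2} ∧
        Q i ∈ Ideal.span {(X 0 : MvPolynomial (Fin 3) K), X 1, X 2}) := by
  intro R α β γ
  have hf : ∀ i, f i ≠ 0 := fun i h => hmin i (h ▸ zero_mem _)
  obtain ⟨u, hu0, hu⟩ := exists_eq_mul_cross hf hsyz
  have hm := X_mem_radical_of_definesReducedPoints hpts hgen hP hQ hu
  have hPQ := isRelPrime_linForm hf hsyz
  have hP0 := linForm_left_ne_zero hf hsyz
  have hPf := left_syzygy hsyz
  have hQf := right_syzygy hsyz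
  have hα₁ : ∀ x, polyOfCoeff SymPair.vars (fun q => α x (Sum.inl q)) =
      -(linForm Q * polyOfCoeff (fun i => {i}) x) := polyOfCoeff_first_map_inl P Q
  have hα₂ : ∀ x, polyOfCoeff SymPair.vars (fun q => α x (Sum.inr q)) =
      linForm P * polyOfCoeff (fun i => {i}) x := polyOfCoeff_first_map_inr P Q
  have hβ : ∀ y, polyOfCoeff SymTriple.vars (β y) =
      linForm P * polyOfCoeff SymPair.vars (fun q => y (Sum.inl q)) +
        linForm Q * polyOfCoeff SymPair.vars (fun q => y (Sum.inr q)) :=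
    polyOfCoeff_middle_map P Q
  have hγ : ∀ v, γ v = eval f (polyOfCoeff SymTriple.vars v) := last_map_eq_eval f
  clear_value α β γ
  have hevP : eval f (linForm P) = 0 := by simpa [linForm] using hPf
  have hevQ : eval f (linForm Q) = 0 := by simpa [linForm] using hQf
  have inj₂ := polyOfCoeff_injective (R := R) SymPair.vars_injective
  have inj₃ := polyOfCoeff_injective (R := R) SymTriple.vars_injective
  refine ⟨?_, ?_, ?_, ?_, fun i => ⟨mem_irrelevant_of_syzygy hmin hP hPf i,
    mem_irrelevant_of_syzygy hmin hQ hQf i⟩⟩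
  · rw [injective_iff_map_eq_zero]
    intro x hx
    have h := hα₂ x
    rw [hx] at h
    refine polyOfCoeff_injective singleton_injective ?_
    rw [map_zero]
    refine (mul_eq_zero.1 (h.symm.trans ?_)).resolve_left hP0
    exact map_zero _
  · ext y
    rw [LinearMap.mem_range, LinearMap.mem_ker]
    constructor
    · rintro ⟨x, rfl⟩
      apply inj₃
      rw [hβ, hα₁, hα₂, map_zero]
      ring
    · intro hy
      have h := hβ y
      rw [hy, map_zero] at h
      have hdvd : linForm P ∣ linForm Q * polyOfCoeff SymPair.vars (fun q => y (Sum.inr q)) :=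
        ⟨-polyOfCoeff SymPair.vars (fun q => y (Sum.inl q)), by linear_combination -h⟩
      obtain ⟨w, hw⟩ := hPQ.dvd_of_dvd_mul_left hdvd
      obtain ⟨x, hx⟩ := exists_linear_eq (homogeneousComponent_isHomogeneous 1 w)
      have h2 := homogeneousComponent_mul_left (linForm_isHomogeneous P) 1 w
      rw [← hw, homogeneousComponent_eq_self
        (polyOfCoeff_symPair_isHomogeneous _), ← hx, ← hα₂] at h2
      have hr := inj₂ h2
      have hl : (fun q => y (Sum.inl q)) = fun q => α x (Sum.inl q) := by
        refine inj₂ (mul_left_cancel₀ hP0 ?_)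
        rw [hα₁]
        rw [hr, hα₂] at h
        linear_combination -h
      refine ⟨x, funext fun q => ?_⟩
      rcases q with q | q
      · exact (congrFun hl q).symm
      · exact (congrFun hr q).symm
  · ext v
    rw [LinearMap.mem_range, LinearMap.mem_ker]
    constructor
    · rintro ⟨y, rfl⟩
      rw [hγ, hβ, map_add, map_mul, map_mul, hevP, hevQ, zero_mul, zero_mul, add_zero]
    · intro hv
      have hM : ∑ q : SymTriple, v q * (crossProduct P Q q.val.1 *
          (crossProduct P Q q.val.2.1 * crossProduct P Q q.val.2.2)) = 0 := by
        refine (mul_eq_zero.1 (?_ : u ^ 3 * _ = 0)).resolve_left (pow_ne_zero 3 hu0)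
        rw [← hv, hγ, polyOfCoeff_symTriple_apply, Finset.mul_sum, map_sum]
        refine Finset.sum_congr rfl fun q _ => ?_
        simp only [map_mul, eval_C, eval_X, hu]
        ring
      obtain ⟨a, b, hab⟩ := Ideal.mem_span_pair.1
        (mem_of_cross_pow_mul_mem hf hsyz hm 3 (cross_pow_mul_mem P Q v hM))
      obtain ⟨y₁, hy₁⟩ := exists_quadratic_eq (homogeneousComponent_isHomogeneous 2 a)
      obtain ⟨y₂, hy₂⟩ := exists_quadratic_eq (homogeneousComponent_isHomogeneous 2 b)
      refine ⟨Sum.elim y₁ y₂, inj₃ ?_⟩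
      rw [hβ]
      simp only [Sum.elim_inl, Sum.elim_inr]
      rw [hy₁, hy₂, ← homogeneousComponent_mul_left (linForm_isHomogeneous P),
        ← homogeneousComponent_mul_left (linForm_isHomogeneous Q), ← map_add, mul_comm _ a,
        mul_comm _ b, hab]
      exact homogeneousComponent_eq_self (polyOfCoeff_symTriple_isHomogeneous v)
  · ext g
    rw [LinearMap.mem_range, hgen]
    refine Iff.trans ?_ (Ideal.mem_span_pow_iff_exists_isHomogeneous f g).symm
    constructor
    · rintro ⟨v, rfl⟩
      exact ⟨_, polyOfCoeff_symTriple_isHomogeneous v, (hγ v).symm⟩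
    · rintro ⟨F, hF, rfl⟩
      obtain ⟨v, rfl⟩ := exists_cubic_eq hF
      exact ⟨v, hγ v⟩

end
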